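/- arXiv:2308.10551 — 4 statements merged into one kernel-verified Lean document; each statement's English description precedes it below -/
import Mathlib

section
/- A nonzero finite-dimensional abelian complex Lie algebra A is capable if and only if dim A ≥ 2. -/
/-- A complex Lie algebra is capable if it is isomorphic to `H/Z(H)` for some Lie algebra `H`. -/
def IsCapable (L : Type) [LieRing L] [LieAlgebra ℂ L] : Prop :=
  ∃ (H : Type) (_i : LieRing H),
    letI := _i
    ∃ _j : LieAlgebra ℂ H,
      letI := _j
      Nonempty (L ≃ₗ⁅ℂ⁆ H ⧸ LieAlgebra.center ℂ H)

open Module in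
/-- The central extension of the vector space `V`, regarded as an abelian Lie algebra, by
`Dual ℂ V →ₗ[ℂ] V`, with bracket `⁅(a, _), (b, _)⁆ = (0, f ↦ f a • b - f b • a)`. -/
def WedgeExtension (V : Type*) [AddCommGroup V] [Module ℂ V] : Type _ :=
  V × (Dual ℂ V →ₗ[ℂ] V)

namespace WedgeExtension

open Module

variable (V : Type*) [AddCommGroup V] [Module ℂ V]

instance : AddCommGroup (WedgeExtension V) :=
  inferInstanceAs (AddCommGroup (V × (Dual ℂ V →ₗ[ℂ] V)))

instance : Module ℂ (WedgeExtension V) :=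
  inferInstanceAs (Module ℂ (V × (Dual ℂ V →ₗ[ℂ] V)))

/-- The projection of the extension onto `V`. -/
def proj : WedgeExtension V →ₗ[ℂ] V := LinearMap.fst ℂ V (Dual ℂ V →ₗ[ℂ] V)

/-- The inclusion of the central part of the extension. -/
def incl : (Dual ℂ V →ₗ[ℂ] V) →ₗ[ℂ] WedgeExtension V :=
  LinearMap.inr ℂ V (Dual ℂ V →ₗ[ℂ] V)

lemma proj_surjective : Function.Surjective (proj V) := LinearMap.fst_surjective

lemma incl_injective : Function.Injective (incl V) := LinearMap.inr_injective

@[simp] lemma proj_incl (w : Dual ℂ V →ₗ[ℂ] V) : proj V (incl V w) = 0 := rfl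

variable {V}

/-- The alternating map `(a, b) ↦ (f ↦ f a • b - f b • a)`. -/
def wedge (a b : V) : Dual ℂ V →ₗ[ℂ] V :=
  (Dual.eval ℂ V a).smulRight b - (Dual.eval ℂ V b).smulRight a

@[simp] lemma wedge_apply (a b : V) (f : Dual ℂ V) : wedge a b f = f a • b - f b • a := rfl

lemma wedge_add_left (a b c : V) : wedge (a + b) c = wedge a c + wedge b c := by
  ext f; simp only [wedge_apply, LinearMap.add_apply, map_add]; module

lemma wedge_add_right (a b c : V) : wedge a (b + c) = wedge a b + wedge a c := by
  ext f; simp only [wedge_apply, LinearMap.add_apply, map_add]; module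

lemma wedge_smul_right (t : ℂ) (a b : V) : wedge a (t • b) = t • wedge a b := by
  ext f; simp only [wedge_apply, LinearMap.smul_apply, map_smul, smul_eq_mul]; module

@[simp] lemma wedge_self (a : V) : wedge a a = 0 := by ext f; simp

@[simp] lemma wedge_zero_left (a : V) : wedge 0 a = 0 := by ext f; simp

@[simp] lemma wedge_zero_right (a : V) : wedge a 0 = 0 := by ext f; simp

instance : Bracket (WedgeExtension V) (WedgeExtension V) where
  bracket x y := incl V (wedge (proj V x) (proj V y))

lemma lie_def (x y : WedgeExtension V) : ⁅x, y⁆ = incl V (wedge (proj V x) (proj V y)) := rfl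

instance : LieRing (WedgeExtension V) where
  add_lie x y z := by simp only [lie_def, map_add, wedge_add_left]
  lie_add x y z := by simp only [lie_def, map_add, wedge_add_right]
  lie_self x := by simp [lie_def]
  leibniz_lie x y z := by simp [lie_def]

instance : LieAlgebra ℂ (WedgeExtension V) where
  lie_smul t x y := by simp only [lie_def, map_smul, wedge_smul_right]

lemma eq_zero_of_forall_wedge_eq_zero (hV : 2 ≤ finrank ℂ V) {a : V}
    (h : ∀ b, wedge b a = 0) : a = 0 := by
  by_contra ha
  obtain ⟨f, hf⟩ := Projective.exists_dual_ne_zero ℂ ha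
  refine absurd (finrank_le_one a fun b ↦ ⟨f b / f a, ?_⟩) (by omega)
  have hb := LinearMap.congr_fun (h b) f
  rw [wedge_apply, LinearMap.zero_apply, sub_eq_zero] at hb
  rw [div_eq_inv_mul, mul_smul, hb, inv_smul_smul₀ hf]

lemma mem_center_iff (hV : 2 ≤ finrank ℂ V) (x : WedgeExtension V) :
    x ∈ LieAlgebra.center ℂ (WedgeExtension V) ↔ proj V x = 0 := by
  rw [LieModule.mem_maxTrivSubmodule]
  refine ⟨fun h ↦ eq_zero_of_forall_wedge_eq_zero hV fun b ↦ ?_, fun h y ↦ by simp [lie_def, h]⟩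
  obtain ⟨y, rfl⟩ := proj_surjective V b
  exact incl_injective V ((h y).trans (map_zero _).symm)

end WedgeExtension

/-- The quotient of a Lie algebra by its center is trivial as soon as it is cyclic as a module. -/
lemma LieAlgebra.subsingleton_quotient_center_of_forall_smul {K L : Type*} [CommRing K]
    [LieRing L] [LieAlgebra K L] (v : L ⧸ LieAlgebra.center K L)
    (hv : ∀ w : L ⧸ LieAlgebra.center K L, ∃ c : K, c • v = w) :
    Subsingleton (L ⧸ LieAlgebra.center K L) := by
  obtain ⟨x, rfl⟩ := LieSubmodule.Quotient.surjective_mk' _ v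
  have key (y : L) : ∃ c : K, ∀ z : L, ⁅z, y⁆ = c • ⁅z, x⁆ := by
    obtain ⟨c, hc⟩ := hv (LieSubmodule.Quotient.mk' _ y)
    refine ⟨c, fun z ↦ ?_⟩
    rw [← map_smul, eq_comm, ← sub_eq_zero, ← map_sub, LieSubmodule.Quotient.mk_eq_zero,
      LieModule.mem_maxTrivSubmodule] at hc
    simpa [sub_eq_zero] using hc z
  have hx (z : L) : ⁅z, x⁆ = 0 := by
    obtain ⟨c, hc⟩ := key z
    rw [← lie_skew, hc x, lie_self, smul_zero, neg_zero]
  refine subsingleton_of_forall_eq 0 fun w ↦ ?_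
  obtain ⟨y, rfl⟩ := LieSubmodule.Quotient.surjective_mk' _ w
  rw [LieSubmodule.Quotient.mk_eq_zero, LieModule.mem_maxTrivSubmodule]
  intro z
  obtain ⟨c, hc⟩ := key y
  rw [hc, hx, smul_zero]

/-- A nonzero finite-dimensional abelian complex Lie algebra `A` is capable
if and only if `dim A ≥ 2`. -/
theorem abelian_isCapable_iff (A : Type) [LieRing A] [LieAlgebra ℂ A]
    [Module.Finite ℂ A] [Nontrivial A] (habelian : IsLieAbelian A) :
    IsCapable A ↔ 2 ≤ Module.finrank ℂ A := by
  constructor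
  · rintro ⟨H, _, _, ⟨e⟩⟩
    by_contra! hlt
    obtain ⟨v, hv⟩ := finrank_le_one_iff.mp (Nat.le_of_lt_succ hlt)
    have := LieAlgebra.subsingleton_quotient_center_of_forall_smul (e v) fun w ↦ by
      obtain ⟨c, hc⟩ := hv (e.symm w)
      exact ⟨c, by rw [← map_smul, hc, e.apply_symm_apply]⟩
    exact not_subsingleton A e.injective.subsingleton
  · intro hA
    let π : WedgeExtension A →ₗ⁅ℂ⁆ A :=
      { WedgeExtension.proj A with
        map_lie' := fun {x y} ↦ by
          exact (trivial_lie_zero A A (WedgeExtension.proj A x) (WedgeExtension.proj A y)).symm }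
    have hker : π.ker = LieAlgebra.center ℂ (WedgeExtension A) := by
      ext x
      rw [LieHom.mem_ker, WedgeExtension.mem_center_iff hA]
      exact Iff.rfl
    have hsurj : Function.Surjective π := WedgeExtension.proj_surjective A
    refine ⟨WedgeExtension A, inferInstance, inferInstance, ?_⟩
    rw [← hker]
    exact ⟨(π.quotKerEquivRange.trans
      ((LieEquiv.ofEq _ _ (by rw [(π.range_eq_top).mpr hsurj])).trans
        LieSubalgebra.topEquiv)).symm⟩
end

section
/- Let L be a finite-dimensional nilpotent complex Lie algebra of nilpotency class two such that dim(L/Z(L)) = r and dim [L,L] = r(r-1)/2. Then L is capable. -/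
/-- A Lie algebra has nilpotency class two if `[L,L] ≠ 0` and `[[L,L],L] = 0`. -/
def IsNilpotentClassTwo (L : Type) [LieRing L] [LieAlgebra ℂ L] : Prop :=
  ⁅(⊤ : LieIdeal ℂ L), (⊤ : LieIdeal ℂ L)⁆ ≠ ⊥ ∧
    ⁅⁅(⊤ : LieIdeal ℂ L), (⊤ : LieIdeal ℂ L)⁆, (⊤ : LieIdeal ℂ L)⁆ = ⊥

open LieModule.Cohomology LieAlgebra in
/-- A Lie algebra is capable if it has a bilinear cocycle with trivial coefficients whose radical
meets the center trivially. -/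
theorem isCapable_of_cocycle {L W : Type} [LieRing L] [LieAlgebra ℂ L] [AddCommGroup W]
    [Module ℂ W] (B : L →ₗ[ℂ] L →ₗ[ℂ] W) (hself : ∀ x, B x x = 0)
    (hcocycle : ∀ x y z, B x ⁅y, z⁆ = B ⁅x, y⁆ z + B y ⁅x, z⁆)
    (hcenter : ∀ z ∈ LieAlgebra.center ℂ L, (∀ y, B z y = 0) → z = 0) : IsCapable L := by
  let _ : LieRingModule L W :=
    { bracket := fun _ _ => 0
      add_lie := by simp
      lie_add := by simp
      leibniz_lie := by simp }
  have hbr (x : L) (w : W) : ⁅x, w⁆ = 0 := rfl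
  have : LieModule ℂ L W :=
    { smul_lie := by simp [hbr]
      lie_smul := by simp [hbr] }
  have : LieModule.IsTrivial L W := ⟨hbr⟩
  let c : twoCocycle ℂ L W :=
    ⟨⟨B, hself⟩, (mem_twoCocycle_iff_of_trivial ℂ L W _).2 hcocycle⟩
  let f : ofTwoCocycle c →ₗ⁅ℂ⁆ L :=
    { toFun := fun x => ((ofProd c).symm x).1
      map_add' := by simp
      map_smul' := by simp
      map_lie' := by simp [bracket_ofTwoCocycle] }
  have hbracket (x y : ofTwoCocycle c) : ⁅x, y⁆ =
      ofProd c (⁅f x, f y⁆, B (f x) (f y)) := by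
    rw [bracket_ofTwoCocycle]
    simp only [hbr, add_zero, sub_zero]
    rfl
  have hzero (u : L) (w : W) : ofProd c (u, w) = 0 ↔ u = 0 ∧ w = 0 := by
    rw [← of_zero c, (ofProd c).apply_eq_iff_eq, Prod.mk_eq_zero]
  have hf : Function.Surjective f := fun x => ⟨ofProd c (x, 0), rfl⟩
  have hker : f.ker = LieAlgebra.center ℂ (ofTwoCocycle c) := by
    ext x
    rw [LieHom.mem_ker, LieModule.mem_maxTrivSubmodule]
    refine ⟨fun hx y => ?_, fun hx => hcenter _ ?_ fun y => ?_⟩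
    · rw [hbracket, hx, lie_zero, map_zero]
      exact of_zero c
    · rw [LieModule.mem_maxTrivSubmodule]
      intro y
      obtain ⟨y, rfl⟩ := hf y
      exact ((hzero _ _).1 ((hbracket y x).symm.trans (hx y))).1
    · obtain ⟨y, rfl⟩ := hf y
      have h : ⁅x, y⁆ = 0 := by rw [← lie_skew, hx y, neg_zero]
      exact ((hzero _ _).1 ((hbracket x y).symm.trans h)).2
  refine ⟨ofTwoCocycle c, inferInstance, inferInstance, ?_⟩
  rw [← hker]
  exact ⟨(f.quotKerEquivRange.trans
    ((LieEquiv.ofEq _ _ (by rw [f.range_eq_top.2 hf])).trans LieSubalgebra.topEquiv)).symm⟩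

/-- A version of `isCapable_of_cocycle` for cocycles of the form
`(x, y) ↦ α y • σ x - α x • σ y`. -/
theorem isCapable_of_functionals {L U ι : Type} [LieRing L] [LieAlgebra ℂ L] [AddCommGroup U]
    [Module ℂ U] (α : ι → L →ₗ[ℂ] ℂ) (σ : ι → L →ₗ[ℂ] U) (hα : ∀ i, ∀ x y : L, α i ⁅x, y⁆ = 0)
    (hcocycle : ∀ i, ∀ x y z : L,
      α i x • σ i ⁅y, z⁆ + α i y • σ i ⁅z, x⁆ + α i z • σ i ⁅x, y⁆ = 0)
    (hcenter : ∀ z ∈ LieAlgebra.center ℂ L,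
      (∀ i y, α i y • σ i z = α i z • σ i y) → z = 0) : IsCapable L := by
  let B : L →ₗ[ℂ] L →ₗ[ℂ] ι → U := LinearMap.mk₂ ℂ (fun x y i => α i y • σ i x - α i x • σ i y)
    (fun _ _ _ => by ext; simp; module) (fun _ _ _ => by ext; simp; module)
    (fun _ _ _ => by ext; simp; module) (fun _ _ _ => by ext; simp; module)
  have hB (x y : L) (i : ι) : B x y i = α i y • σ i x - α i x • σ i y := rfl
  refine isCapable_of_cocycle B (fun x => by ext; simp [hB]) (fun x y z => ?_) fun z hz h => ?_
  · ext i
    have h := hcocycle i x y z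
    rw [← lie_skew z x, map_neg] at h
    simp only [Pi.add_apply, hB, hα, zero_smul, zero_sub, sub_zero]
    rw [← sub_eq_zero, ← neg_eq_zero, ← h]
    module
  · exact hcenter z hz fun i y => sub_eq_zero.1 (by rw [← hB, h]; rfl)

theorem Fintype.card_subtype_fst_lt_snd (r : ℕ) :
    Fintype.card {p : Fin r × Fin r // p.1 < p.2} = r * (r - 1) / 2 := by
  rw [Fintype.card_subtype, ← Finset.sum_range_id, Finset.sum_range, Finset.card_filter,
    Fintype.sum_prod_type_right]
  refine Finset.sum_congr rfl fun j _ => ?_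
  rw [← Finset.card_filter, Finset.filter_gt_eq_Iio, Fin.card_Iio]

section CenterQuotient

variable {K L : Type*} [Field K] [LieRing L] [LieAlgebra K L]

theorem exists_coordinates_mod_center [Module.Finite K L] :
    ∃ (x : Fin (Module.finrank K (L ⧸ LieAlgebra.center K L)) → L)
      (α : Fin (Module.finrank K (L ⧸ LieAlgebra.center K L)) → L →ₗ[K] K),
      (∀ i j, α i (x j) = if j = i then 1 else 0) ∧
      (∀ i, ∀ z ∈ LieAlgebra.center K L, α i z = 0) ∧
      ∀ u, u - ∑ i, α i u • x i ∈ LieAlgebra.center K L := by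
  let π : L →ₗ[K] L ⧸ LieAlgebra.center K L :=
    (LieSubmodule.Quotient.mk' (LieAlgebra.center K L)).toLinearMap
  have hπ (z : L) : π z = 0 ↔ z ∈ LieAlgebra.center K L := LieSubmodule.Quotient.mk_eq_zero _
  let b := Module.finBasis K (L ⧸ LieAlgebra.center K L)
  choose x hx using fun i =>
    LieSubmodule.Quotient.surjective_mk' (LieAlgebra.center K L) (b i)
  replace hx (i) : π (x i) = b i := hx i
  refine ⟨x, fun i => b.coord i ∘ₗ π, fun i j => ?_, fun i z hz => ?_, fun u => ?_⟩
  · simp [hx, Finsupp.single_apply]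
  · simp [(hπ z).2 hz]
  · rw [← hπ]
    simp [hx, b.sum_repr]

theorem lie_eq_sum_of_coordinates {ι : Type*} [Fintype ι] {x : ι → L} {α : ι → L →ₗ[K] K}
    (h : ∀ u, u - ∑ i, α i u • x i ∈ LieAlgebra.center K L) (u v : L) :
    ⁅u, v⁆ = ∑ i, ∑ j, (α i u * α j v) • ⁅x i, x j⁆ := by
  have hr (w y : L) : ⁅y, w⁆ = ⁅y, ∑ i, α i w • x i⁆ := by
    rw [← sub_eq_zero, ← lie_sub]
    exact (LieModule.mem_maxTrivSubmodule K L L _).1 (h w) y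
  have hl (w y : L) : ⁅w, y⁆ = ⁅∑ i, α i w • x i, y⁆ := by
    rw [← lie_skew, hr w y, lie_skew]
  rw [hl u v, hr v]
  simp only [sum_lie_sum, smul_lie, lie_smul, smul_smul, mul_comm]

theorem lie_mem_derived (u v : L) :
    ⁅u, v⁆ ∈ ⁅(⊤ : LieIdeal K L), (⊤ : LieIdeal K L)⁆ :=
  LieSubmodule.lie_mem_lie (LieSubmodule.mem_top u) (LieSubmodule.mem_top v)

theorem span_lie_of_coordinates {ι : Type*} [Fintype ι] [LinearOrder ι] {x : ι → L}
    {α : ι → L →ₗ[K] K} (h : ∀ u, u - ∑ i, α i u • x i ∈ LieAlgebra.center K L) :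
    Submodule.span K (Set.range fun p : {p : ι × ι // p.1 < p.2} =>
      (⟨⁅x p.1.1, x p.1.2⁆, lie_mem_derived _ _⟩ :
        (⁅(⊤ : LieIdeal K L), (⊤ : LieIdeal K L)⁆ : LieIdeal K L))) = ⊤ := by
  set D : LieIdeal K L := ⁅(⊤ : LieIdeal K L), (⊤ : LieIdeal K L)⁆ with hD
  set v : {p : ι × ι // p.1 < p.2} → D := fun p => ⟨⁅x p.1.1, x p.1.2⁆, lie_mem_derived _ _⟩
  set S := (Submodule.span K (Set.range v)).map D.toSubmodule.subtype
  have hlt {i j : ι} (hij : i < j) : ⁅x i, x j⁆ ∈ S :=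
    ⟨v ⟨(i, j), hij⟩, Submodule.subset_span ⟨_, rfl⟩, rfl⟩
  have hmem (i j : ι) : ⁅x i, x j⁆ ∈ S := by
    rcases lt_trichotomy i j with hij | rfl | hij
    · exact hlt hij
    · rw [lie_self]
      exact S.zero_mem
    · rw [← lie_skew]
      exact S.neg_mem (hlt hij)
  have hDS : D.toSubmodule ≤ S := by
    rw [hD, LieSubmodule.lieIdeal_oper_eq_linear_span', Submodule.span_le]
    rintro _ ⟨u, -, w, -, rfl⟩
    rw [lie_eq_sum_of_coordinates h]
    exact S.sum_mem fun i _ => S.sum_mem fun j _ => S.smul_mem _ (hmem i j)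
  refine eq_top_iff.2 fun d _ => ?_
  obtain ⟨d', hd', hdd'⟩ := hDS d.2
  rwa [← Subtype.ext hdd']

end CenterQuotient

/-- Let `L` be a finite-dimensional nilpotent complex Lie algebra of nilpotency class two
such that `dim (L/Z(L)) = r` and `dim [L,L] = r(r-1)/2`.  Then `L` is capable. -/
theorem isCapable_of_classTwo_dim_center_quot (L : Type) [LieRing L] [LieAlgebra ℂ L]
    [Module.Finite ℂ L] (r : ℕ) (h2 : IsNilpotentClassTwo L)
    (hZ : Module.finrank ℂ (L ⧸ LieAlgebra.center ℂ L) = r)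
    (hder : Module.finrank ℂ
      (⁅(⊤ : LieIdeal ℂ L), (⊤ : LieIdeal ℂ L)⁆ : LieIdeal ℂ L) = r * (r - 1) / 2) :
    IsCapable L := by
  subst hZ
  obtain ⟨x, α, hαx, hα, hx⟩ := exists_coordinates_mod_center (K := ℂ) (L := L)
  obtain ⟨hne, hnil⟩ := h2
  have hderx := lie_mem_derived (K := ℂ) (L := L)
  have hspan := span_lie_of_coordinates hx
  set D : LieIdeal ℂ L := ⁅(⊤ : LieIdeal ℂ L), (⊤ : LieIdeal ℂ L)⁆
  have hcard := (Fintype.card_subtype_fst_lt_snd _).trans hder.symm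
  let b := basisOfTopLeSpanOfCardEqFinrank _ hspan.ge hcard
  have hb (p) : (b p : L) = ⁅x p.1.1, x p.1.2⁆ := by
    simp [b]
  have hcentral (u v : L) : ⁅u, v⁆ ∈ LieAlgebra.center ℂ L := by
    rw [LieModule.mem_maxTrivSubmodule]
    intro w
    rw [← lie_skew, neg_eq_zero, ← LieSubmodule.mem_bot (R := ℂ) (L := L), ← hnil]
    exact LieSubmodule.lie_mem_lie (hderx u v) (LieSubmodule.mem_top w)
  choose φ hφ using fun p => LinearMap.exists_extend (p := D.toSubmodule) (b.coord p)
  replace hφ (p) (d : D) : φ p d = b.repr d p := LinearMap.congr_fun (hφ p) d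
  have hφlt (p i j) (hij : i < j) : φ p ⁅x i, x j⁆ = α p.1.1 (x i) * α p.1.2 (x j) -
      α p.1.1 (x j) * α p.1.2 (x i) := by
    have h := hφ p (b ⟨(i, j), hij⟩)
    rw [hb, b.repr_self] at h
    rw [h, Finsupp.single_apply]
    obtain ⟨⟨k, l⟩, hkl⟩ := p
    simp only [hαx, Subtype.mk.injEq, Prod.mk.injEq]
    grind
  have hφx (p i j) : φ p ⁅x i, x j⁆ = α p.1.1 (x i) * α p.1.2 (x j) -
      α p.1.1 (x j) * α p.1.2 (x i) := by
    rcases lt_trichotomy i j with hij | rfl | hij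
    · exact hφlt p i j hij
    · simp
    · rw [← lie_skew, map_neg, hφlt p j i hij]
      ring
  have hφlie (p) (u v : L) : φ p ⁅u, v⁆ = α p.1.1 u * α p.1.2 v - α p.1.1 v * α p.1.2 u := by
    rw [lie_eq_sum_of_coordinates hx u v]
    simp only [map_sum, map_smul, hφx, hαx, smul_eq_mul]
    simp [mul_sub, Finset.sum_sub_distrib]
    ring
  let σ p : L →ₗ[ℂ] ℂ × (L ⧸ D) := (φ p).prod (LieSubmodule.Quotient.mk' D).toLinearMap
  have hσ (p u) : σ p u = (φ p u, LieSubmodule.Quotient.mk' D u) := rfl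
  have hσlie (p) (u v : L) : σ p ⁅u, v⁆ = (φ p ⁅u, v⁆, 0) := by
    rw [hσ, (LieSubmodule.Quotient.mk_eq_zero _).2 (hderx u v)]
  refine isCapable_of_functionals (fun p => α p.1.1) σ
    (fun p u v => hα _ _ (hcentral u v)) (fun p u v w => ?_) fun z hz h => ?_
  · simp only [hσlie, hφlie, Prod.smul_mk, Prod.mk_add_mk, smul_zero, add_zero, smul_eq_mul]
    ext
    · simp only [Prod.fst_zero]
      ring
    · rfl
  · have hσz (p) : σ p z = 0 := by
      have := h p (x p.1.1)
      simpa only [hαx, if_true, one_smul, hα _ z hz, zero_smul] using this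
    obtain ⟨p⟩ : Nonempty {p : _ × _ // p.1 < p.2} := by
      by_contra hempty
      rw [not_nonempty_iff] at hempty
      refine hne ((LieSubmodule.eq_bot_iff _).2 fun d hd => ?_)
      have : (⟨d, hd⟩ : D) = 0 := b.ext_elem fun p => hempty.elim p
      exact congrArg Subtype.val this
    have hzD : z ∈ D := (LieSubmodule.Quotient.mk_eq_zero _).1 (congrArg Prod.snd (hσz p))
    have : (⟨z, hzD⟩ : D) = 0 := b.ext_elem fun p => by
      rw [← hφ p, map_zero]
      exact congrArg Prod.fst (hσz p)
    exact congrArg Subtype.val this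
end

section
/- Let A be the m-dimensional abelian complex Lie algebra and let π : F → A be any surjective Lie algebra homomorphism from a free Lie algebra F over ℂ with kernel R. Then the Schur multiplier (R ∩ [F,F])/[F,R] has dimension m(m-1)/2 over ℂ. -/
/-- The dimension of the Schur multiplier `(R ∩ [F,F]) / [F,R]` associated to a free
presentation `π : F → L`, where `F = FreeLieAlgebra ℂ X` is a free Lie algebra and
`R = ker π`. -/
noncomputable def schurMultiplierDim {X : Type} {L : Type} [LieRing L] [LieAlgebra ℂ L]
    (π : FreeLieAlgebra ℂ X →ₗ⁅ℂ⁆ L) : ℕ :=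
  let F := FreeLieAlgebra ℂ X
  let R : LieIdeal ℂ F := π.ker
  let D : LieIdeal ℂ F := ⁅(⊤ : LieIdeal ℂ F), (⊤ : LieIdeal ℂ F)⁆
  let FR : LieIdeal ℂ F := ⁅(⊤ : LieIdeal ℂ F), R⁆
  Module.finrank ℂ
    (↥(R.toSubmodule ⊓ D.toSubmodule) ⧸
      (FR.toSubmodule.comap (R.toSubmodule ⊓ D.toSubmodule).subtype))

/-- An alternating bilinear map on an abelian quotient `L` of a free Lie algebra lifts to a linear
map computing it on brackets. The lift is the vertical component of a homomorphism into the central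
extension of `L` defined by the alternating map. -/
theorem FreeLieAlgebra.exists_linearMap_lie_eq {K X L W : Type*} [CommRing K] [LieRing L]
    [LieAlgebra K L] [IsLieAbelian L] [AddCommGroup W] [Module K W]
    (π : FreeLieAlgebra K X →ₗ⁅K⁆ L) (f : L →ₗ[K] L →ₗ[K] W) (hf : f.IsAlt) :
    ∃ ψ : FreeLieAlgebra K X →ₗ[K] W, ∀ x y, ψ ⁅x, y⁆ = f (π x) (π y) := by
  let : LieRingModule L W :=
    { bracket := fun _ _ => 0
      add_lie := fun _ _ _ => (add_zero 0).symm
      lie_add := fun _ _ _ => (add_zero 0).symm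
      leibniz_lie := fun _ _ _ => (add_zero 0).symm }
  have : LieModule.IsTrivial L W := ⟨fun _ _ => rfl⟩
  have : LieModule K L W :=
    { smul_lie := fun t _ _ => (smul_zero t).symm
      lie_smul := fun t _ _ => (smul_zero t).symm }
  let c : LieModule.Cohomology.twoCocycle K L W := ⟨⟨f, hf⟩, by
    rw [LieModule.Cohomology.mem_twoCocycle_iff_of_trivial]
    intro x y z
    simp [trivial_lie_zero]⟩
  let E := LieAlgebra.ofTwoCocycle c
  let e := LieAlgebra.ofProd c
  let φ : FreeLieAlgebra K X →ₗ⁅K⁆ E :=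
    FreeLieAlgebra.lift K fun x => e (π (FreeLieAlgebra.of K x), 0)
  let p : E →ₗ⁅K⁆ L :=
    { toFun := fun x => (e.symm x).1
      map_add' := fun _ _ => rfl
      map_smul' := fun _ _ => rfl
      map_lie' := fun {_ _} => rfl }
  let q : E →ₗ[K] W :=
    { toFun := fun x => (e.symm x).2
      map_add' := fun _ _ => rfl
      map_smul' := fun _ _ => rfl }
  have hp : p.comp φ = π := by
    ext x
    simp only [φ, LieHom.comp_apply, FreeLieAlgebra.lift_of_apply]
    rfl
  have hq (u v : E) : q ⁅u, v⁆ = f (p u) (p v) := by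
    change f (p u) (p v) + 0 - 0 = _
    simp
  refine ⟨q ∘ₗ φ, fun x y => ?_⟩
  have hx := LieHom.congr_fun hp x
  have hy := LieHom.congr_fun hp y
  simp only [LieHom.comp_apply] at hx hy
  simp [hq, hx, hy]

/-- For a presentation `π : F → A` of an abelian Lie algebra with kernel `R`, the Schur multiplier
`(R ∩ [F, F]) / [F, R]` is isomorphic to the exterior square of `A`. -/
theorem FreeLieAlgebra.nonempty_schurMultiplier_equiv_exteriorPower {K X A : Type*} [Field K]
    [LieRing A] [LieAlgebra K A] [IsLieAbelian A]
    (π : FreeLieAlgebra K X →ₗ⁅K⁆ A) (hπ : Function.Surjective π)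
    (D FR : LieIdeal K (FreeLieAlgebra K X))
    (hD : D = ⁅(⊤ : LieIdeal K (FreeLieAlgebra K X)), (⊤ : LieIdeal K (FreeLieAlgebra K X))⁆)
    (hFR : FR = ⁅(⊤ : LieIdeal K (FreeLieAlgebra K X)), π.ker⁆) :
    Nonempty ((↥(π.ker.toSubmodule ⊓ D.toSubmodule) ⧸
      (FR.toSubmodule.comap (π.ker.toSubmodule ⊓ D.toSubmodule).subtype)) ≃ₗ[K] ⋀[K]^2 A) := by
  have hup (a b c : A) : Function.update ![a, b] 1 c = ![a, c] := by
    ext i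
    fin_cases i <;> rfl
  let w : A →ₗ[K] A →ₗ[K] ⋀[K]^2 A := LinearMap.mk₂ K (fun a b => exteriorPower.ιMulti K 2 ![a, b])
    (fun a a' b => (exteriorPower.ιMulti K 2).toMultilinearMap.cons_add ![b] a a')
    (fun t a b => (exteriorPower.ιMulti K 2).toMultilinearMap.cons_smul ![b] t a)
    (fun a b b' => by
      have h := (exteriorPower.ιMulti K 2 (M := A)).map_update_add ![a, b] 1 b b'
      simpa only [hup] using h)
    (fun t a b => by
      have h := (exteriorPower.ιMulti K 2 (M := A)).map_update_smul ![a, b] 1 t b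
      simpa only [hup] using h)
  have hw : w.IsAlt := fun a =>
    (exteriorPower.ιMulti K 2).map_eq_zero_of_eq ![a, a] (i := 0) (j := 1) rfl (by decide)
  obtain ⟨ψ, hψ⟩ := exists_linearMap_lie_eq π w hw
  have hDspan : D.toSubmodule = Submodule.span K {z | ∃ x y : FreeLieAlgebra K X, ⁅x, y⁆ = z} := by
    rw [hD, LieSubmodule.lieIdeal_oper_eq_linear_span']
    simp
  have hFRspan : FR.toSubmodule = Submodule.span K {z | ∃ x r : FreeLieAlgebra K X, π r = 0 ∧ ⁅x, r⁆ = z} := by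
    rw [hFR, LieSubmodule.lieIdeal_oper_eq_linear_span']
    simp [LieHom.mem_ker]
  obtain ⟨s, hs⟩ := (π : FreeLieAlgebra K X →ₗ[K] A).exists_rightInverse_of_surjective
    (LinearMap.range_eq_top.2 hπ)
  replace hs (a : A) : π (s a) = a := LinearMap.congr_fun hs a
  let mk := FR.toSubmodule.mkQ
  let β : A [⋀^Fin 2]→ₗ[K] (FreeLieAlgebra K X ⧸ FR.toSubmodule) :=
    mk.compAlternatingMap
      { toFun := fun a => ⁅s (a 0), s (a 1)⁆
        map_update_add' := fun a i x y => by
          fin_cases i <;> simp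
        map_update_smul' := fun a i t x => by
          fin_cases i <;> simp
        map_eq_zero_of_eq' := fun a i j h hij => by
          fin_cases i <;> fin_cases j <;> simp_all }
  let γ := exteriorPower.alternatingMapLinearEquiv β
  have hlie_mem (x r : FreeLieAlgebra K X) (hr : π r = 0) : ⁅x, r⁆ ∈ FR.toSubmodule := by
    rw [hFRspan]
    exact Submodule.subset_span ⟨x, r, hr, rfl⟩
  have hγ : ∀ d ∈ D.toSubmodule, γ (ψ d) = mk d := by
    rw [hDspan]
    intro d hd
    induction hd using Submodule.span_induction with
    | mem d hd =>
      obtain ⟨x, y, rfl⟩ := hd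
      rw [hψ]
      change γ (exteriorPower.ιMulti K 2 ![π x, π y]) = _
      rw [exteriorPower.alternatingMapLinearEquiv_apply_ιMulti]
      change mk ⁅s (π x), s (π y)⁆ = _
      rw [← sub_eq_zero, ← map_sub, Submodule.mkQ_apply, Submodule.Quotient.mk_eq_zero]
      have h : ⁅s (π x), s (π y)⁆ - ⁅x, y⁆ =
          ⁅s (π x), s (π y) - y⁆ - ⁅y, s (π x) - x⁆ := by
        rw [lie_sub, lie_sub, ← lie_skew y, ← lie_skew y x]
        abel
      rw [h]
      exact Submodule.sub_mem _ (hlie_mem _ _ (by simp [hs])) (hlie_mem _ _ (by simp [hs]))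
    | zero => simp
    | add x y _ _ hx hy => simp [hx, hy]
    | smul t x _ hx => simp [hx]
  have hDker : D.toSubmodule ≤ π.ker.toSubmodule := by
    rw [hDspan, Submodule.span_le]
    rintro _ ⟨x, y, rfl⟩
    simp [trivial_lie_zero]
  have hψFR : FR.toSubmodule ≤ LinearMap.ker ψ := by
    rw [hFRspan, Submodule.span_le]
    rintro _ ⟨x, r, hr, rfl⟩
    simp [hψ, hr]
  let g := ψ ∘ₗ (π.ker.toSubmodule ⊓ D.toSubmodule).subtype
  have hker : LinearMap.ker g =
      FR.toSubmodule.comap (π.ker.toSubmodule ⊓ D.toSubmodule).subtype := by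
    ext d
    refine ⟨fun hd => ?_, fun hd => hψFR hd⟩
    have h := hγ d d.2.2
    rw [show ψ d = 0 from hd, map_zero] at h
    exact (Submodule.Quotient.mk_eq_zero FR.toSubmodule).1 h.symm
  have hsurj : LinearMap.range g = ⊤ := by
    rw [eq_top_iff, ← exteriorPower.ιMulti_span, Submodule.span_le]
    rintro _ ⟨a, rfl⟩
    have hmem : ⁅s (a 0), s (a 1)⁆ ∈ D.toSubmodule := by
      rw [hDspan]
      exact Submodule.subset_span ⟨_, _, rfl⟩
    refine ⟨⟨⁅s (a 0), s (a 1)⁆, hDker hmem, hmem⟩, ?_⟩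
    change ψ ⁅s (a 0), s (a 1)⁆ = _
    rw [hψ, hs, hs]
    change exteriorPower.ιMulti K 2 ![a 0, a 1] = _
    congr 1
    ext i
    fin_cases i <;> rfl
  rw [← hker]
  exact ⟨g.quotKerEquivOfSurjective (LinearMap.range_eq_top.1 hsurj)⟩

/-- The Schur multiplier of the `m`-dimensional abelian complex Lie algebra has
dimension `m(m-1)/2`, computed from any free presentation. -/
theorem schurMultiplierDim_abelian (m : ℕ) (A : Type) [LieRing A] [LieAlgebra ℂ A]
    [Module.Finite ℂ A] (habelian : IsLieAbelian A) (hdim : Module.finrank ℂ A = m)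
    (X : Type) (π : FreeLieAlgebra ℂ X →ₗ⁅ℂ⁆ A) (hπ : Function.Surjective π) :
    schurMultiplierDim π = m * (m - 1) / 2 := by
  obtain ⟨e⟩ := FreeLieAlgebra.nonempty_schurMultiplier_equiv_exteriorPower π hπ _ _ rfl rfl
  rw [← Nat.choose_two_right, ← hdim, ← exteriorPower.finrank_eq]
  exact e.finrank_eq
end

section
/- Let H and K be finite-dimensional complex Lie algebras. Then dim M(H ⊕ K) = dim M(H) + dim M(K) + dim(H/[H,H]) · dim(K/[K,K]), where M(-) denotes the Schur multiplier computed from any free presentation and H ⊕ K is the Lie algebra direct sum. -/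
/-- The Lie algebra direct sum `H ⊕ K`, realized as the product `H × K` with
componentwise bracket. -/
instance Prod.instLieRingOfLieRing {L M : Type} [LieRing L] [LieRing M] :
    LieRing (L × M) where
  bracket p q := (⁅p.1, q.1⁆, ⁅p.2, q.2⁆)
  add_lie x y z := by
    show (⁅x.1 + y.1, z.1⁆, ⁅x.2 + y.2, z.2⁆) = _
    simp [add_lie, Prod.ext_iff]
  lie_add x y z := by
    show (⁅x.1, y.1 + z.1⁆, ⁅x.2, y.2 + z.2⁆) = _
    simp [lie_add, Prod.ext_iff]
  lie_self x := by
    show (⁅x.1, x.1⁆, ⁅x.2, x.2⁆) = _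
    simp
  leibniz_lie x y z := by
    show (⁅x.1, ⁅y.1, z.1⁆⁆, ⁅x.2, ⁅y.2, z.2⁆⁆) = _
    simp [Prod.ext_iff]

instance Prod.instLieAlgebraOfLieAlgebra {R : Type} [CommRing R] {L M : Type}
    [LieRing L] [LieRing M] [LieAlgebra R L] [LieAlgebra R M] :
    LieAlgebra R (L × M) where
  lie_smul t x y := Prod.ext (lie_smul t x.1 y.1) (lie_smul t x.2 y.2)

open Module

/-- Scalar 2-cocycles of a Lie algebra: alternating bilinear forms satisfying the cocycle
identity for trivial coefficients. -/
def scalarTwoCocycle (k L : Type*) [Field k] [LieRing L] [LieAlgebra k L] :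
    Submodule k (L →ₗ[k] L →ₗ[k] k) where
  carrier := {ω | (∀ x, ω x x = 0) ∧ ∀ x y z, ω ⁅x, y⁆ z + ω ⁅y, z⁆ x + ω ⁅z, x⁆ y = 0}
  add_mem' {a b} ha hb := ⟨fun x => by simp [ha.1, hb.1], fun x y z => by
    simp only [LinearMap.add_apply]
    linear_combination ha.2 x y z + hb.2 x y z⟩
  zero_mem' := by simp
  smul_mem' t a ha := ⟨fun x => by simp [ha.1], fun x y z => by
    simp only [LinearMap.smul_apply, smul_eq_mul]
    linear_combination t * ha.2 x y z⟩

namespace scalarTwoCocycle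

set_option maxSynthPendingDepth 3

section

variable {k L : Type*} [Field k] [LieRing L] [LieAlgebra k L]

theorem skew (ω : scalarTwoCocycle k L) (x y : L) : ω.1 x y = -ω.1 y x := by
  have h := ω.2.1 (x + y)
  simp only [map_add, LinearMap.add_apply, ω.2.1 x, ω.2.1 y] at h
  linear_combination h

variable (k L) in
/-- The coboundary of a linear functional `f` is the 2-cocycle `(x, y) ↦ f ⁅x, y⁆`. -/
def coboundary : Dual k L →ₗ[k] scalarTwoCocycle k L where
  toFun f := ⟨LinearMap.mk₂ k (fun x y => f ⁅x, y⁆) (by simp) (by simp) (by simp) (by simp), by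
    refine ⟨fun x => by simp, fun x y z => ?_⟩
    simp only [LinearMap.mk₂_apply, ← map_add]
    rw [show ⁅⁅x, y⁆, z⁆ + ⁅⁅y, z⁆, x⁆ + ⁅⁅z, x⁆, y⁆ = 0 by
      rw [← lie_skew ⁅x, y⁆ z, ← lie_skew ⁅y, z⁆ x, ← lie_skew ⁅z, x⁆ y]
      rw [← neg_add, ← neg_add, lie_jacobi, neg_zero], map_zero]⟩
  map_add' _ _ := rfl
  map_smul' _ _ := rfl

@[simp]
theorem coboundary_apply (f : Dual k L) (x y : L) : (coboundary k L f).1 x y = f ⁅x, y⁆ := rfl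

/-- The central extension of `L` by the ground field defined by a scalar 2-cocycle. -/
@[ext]
structure CentralExtension (ω : scalarTwoCocycle k L) where
  /-- The component in the base Lie algebra. -/
  base : L
  /-- The central component. -/
  central : k

namespace CentralExtension

variable {ω : scalarTwoCocycle k L}

/-- The underlying pair of an element of a central extension. -/
def equivProd (ω : scalarTwoCocycle k L) : CentralExtension ω ≃ L × k where
  toFun p := (p.base, p.central)
  invFun p := ⟨p.1, p.2⟩

instance : AddCommGroup (CentralExtension ω) := (equivProd ω).addCommGroup

instance : Module k (CentralExtension ω) := (equivProd ω).module k

@[simp] theorem base_zero : (0 : CentralExtension ω).base = 0 := rfl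
@[simp] theorem central_zero : (0 : CentralExtension ω).central = 0 := rfl
@[simp] theorem base_add (p q : CentralExtension ω) : (p + q).base = p.base + q.base := rfl
@[simp] theorem central_add (p q : CentralExtension ω) :
    (p + q).central = p.central + q.central := rfl
@[simp] theorem base_smul (t : k) (p : CentralExtension ω) : (t • p).base = t • p.base := rfl
@[simp] theorem central_smul (t : k) (p : CentralExtension ω) :
    (t • p).central = t * p.central := rfl

instance : Bracket (CentralExtension ω) (CentralExtension ω) where
  bracket p q := ⟨⁅p.base, q.base⁆, ω.1 p.base q.base⟩

@[simp] theorem base_lie (p q : CentralExtension ω) : ⁅p, q⁆.base = ⁅p.base, q.base⁆ := rfl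
@[simp] theorem central_lie (p q : CentralExtension ω) :
    ⁅p, q⁆.central = ω.1 p.base q.base := rfl

instance : LieRing (CentralExtension ω) where
  add_lie p q r := by ext <;> simp
  lie_add p q r := by ext <;> simp
  lie_self p := by ext <;> simp [ω.2.1]
  leibniz_lie p q r := by
    ext
    · simp
    · simp only [central_lie, base_lie, central_add]
      have h := ω.2.2 p.base q.base r.base
      have h' := skew ω p.base ⁅q.base, r.base⁆
      have h'' := skew ω q.base ⁅p.base, r.base⁆
      have hskew : ω.1 ⁅p.base, r.base⁆ q.base = -ω.1 ⁅r.base, p.base⁆ q.base := by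
        rw [← lie_skew, map_neg, LinearMap.neg_apply]
      linear_combination h' - h - h'' + hskew

instance : LieAlgebra k (CentralExtension ω) where
  lie_smul t p q := by ext <;> simp

/-- The projection of a central extension onto its base. -/
def proj (ω : scalarTwoCocycle k L) : CentralExtension ω →ₗ⁅k⁆ L where
  toFun := base
  map_add' _ _ := rfl
  map_smul' _ _ := rfl
  map_lie' := rfl

/-- The linear projection of a central extension onto its central component. -/
def centralProj (ω : scalarTwoCocycle k L) : CentralExtension ω →ₗ[k] k where
  toFun := central
  map_add' _ _ := rfl
  map_smul' _ _ := rfl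

end CentralExtension

/-- The pullback of a scalar 2-cocycle to a free Lie algebra is a coboundary. -/
theorem exists_primitive_of_free {X : Type*} (π : FreeLieAlgebra k X →ₗ⁅k⁆ L)
    (ω : scalarTwoCocycle k L) :
    ∃ g : Dual k (FreeLieAlgebra k X), ∀ x y, g ⁅x, y⁆ = ω.1 (π x) (π y) := by
  let s : FreeLieAlgebra k X →ₗ⁅k⁆ CentralExtension ω :=
    FreeLieAlgebra.lift k fun x => ⟨π (FreeLieAlgebra.of k x), 0⟩
  have hs : (CentralExtension.proj ω).comp s = π := by
    ext x
    exact congrArg CentralExtension.base (FreeLieAlgebra.lift_of_apply _ x)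
  have hs' (x) : (s x).base = π x := DFunLike.congr_fun hs x
  refine ⟨CentralExtension.centralProj ω ∘ₗ (s : FreeLieAlgebra k X →ₗ[k] _), fun x y => ?_⟩
  change (s ⁅x, y⁆).central = _
  rw [LieHom.map_lie, CentralExtension.central_lie, hs', hs']

/-- Functionals on `F` killing all brackets with the kernel of a surjection `F → L` descend
to scalar 2-cocycles on `L`. -/
theorem exists_descent {F : Type*} [LieRing F] [LieAlgebra k F] (π : F →ₗ⁅k⁆ L)
    (hπ : Function.Surjective π) :
    ∃ Φ : (⁅(⊤ : LieIdeal k F), π.ker⁆).toSubmodule.dualAnnihilator →ₗ[k] scalarTwoCocycle k L,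
      ∀ g x y, (Φ g).1 (π x) (π y) = g.1 ⁅x, y⁆ := by
  obtain ⟨σ, hσ⟩ := LinearMap.exists_rightInverse_of_surjective (π : F →ₗ[k] L)
    (LinearMap.range_eq_top.2 hπ)
  replace hσ (x) : π (σ x) = x := DFunLike.congr_fun hσ x
  set A := (⁅(⊤ : LieIdeal k F), π.ker⁆).toSubmodule.dualAnnihilator
  have kill (g : A) (x r : F) (hr : π r = 0) : g.1 ⁅x, r⁆ = 0 :=
    (Submodule.mem_dualAnnihilator _).1 g.2 _
      (LieSubmodule.lie_mem_lie (LieSubmodule.mem_top x) (LieHom.mem_ker.2 hr))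
  have kill' (g : A) (x y y' : F) (h : π y = π y') : g.1 ⁅x, y⁆ = g.1 ⁅x, y'⁆ := by
    rw [← sub_eq_zero, ← map_sub, ← lie_sub]
    exact kill g x _ (by rw [map_sub, h, sub_self])
  have kill'' (g : A) (x x' y : F) (h : π x = π x') : g.1 ⁅x, y⁆ = g.1 ⁅x', y⁆ := by
    rw [← lie_skew, ← lie_skew x', map_neg, map_neg, kill' g y x x' h]
  have key (g : A) (x y : F) : g.1 ⁅σ (π x), σ (π y)⁆ = g.1 ⁅x, y⁆ := by
    rw [kill' g _ _ y (hσ _), kill'' g _ x y (hσ _)]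
  have hmem (g : A) : (coboundary k F g.1).1.compl₁₂ σ σ ∈ scalarTwoCocycle k L := by
    refine ⟨fun x => by simp, fun x y z => ?_⟩
    have h := (coboundary k F g.1).2.2 (σ x) (σ y) (σ z)
    simp only [coboundary_apply, LinearMap.compl₁₂_apply] at h ⊢
    rwa [kill'' g (σ ⁅x, y⁆) ⁅σ x, σ y⁆ _ (by simp [hσ]),
      kill'' g (σ ⁅y, z⁆) ⁅σ y, σ z⁆ _ (by simp [hσ]),
      kill'' g (σ ⁅z, x⁆) ⁅σ z, σ x⁆ _ (by simp [hσ])]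
  exact ⟨{ toFun := fun g => ⟨_, hmem g⟩, map_add' := fun _ _ => rfl,
           map_smul' := fun _ _ => rfl }, key⟩

end

end scalarTwoCocycle

/-- Two surjective linear maps with the same kernel have targets of the same dimension. -/
theorem LinearMap.finrank_eq_of_surjective_of_ker_eq {k A B C : Type*} [Field k]
    [AddCommGroup A] [Module k A] [AddCommGroup B] [Module k B] [AddCommGroup C] [Module k C]
    {f : A →ₗ[k] B} {g : A →ₗ[k] C} (hf : Function.Surjective f) (hg : Function.Surjective g)
    (h : ∀ a, f a = 0 ↔ g a = 0) : finrank k B = finrank k C := by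
  have hker : LinearMap.ker f = LinearMap.ker g := by
    ext a
    exact h a
  exact ((f.quotKerEquivOfSurjective hf).symm ≪≫ₗ Submodule.quotEquivOfEq _ _ hker ≪≫ₗ
    g.quotKerEquivOfSurjective hg).finrank_eq

/-- For `W ≤ N`, every functional on `N / W` is induced by a functional killing `W`. -/
theorem Submodule.exists_dualAnnihilator_to_dual_quotient {k V : Type*} [Field k]
    [AddCommGroup V] [Module k V] {W N : Submodule k V} (hWN : W ≤ N) :
    ∃ Ψ : W.dualAnnihilator →ₗ[k] Dual k (N ⧸ W.comap N.subtype),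
      Function.Surjective Ψ ∧ ∀ g, Ψ g = 0 ↔ ∀ x ∈ N, g.1 x = 0 := by
  have hle (g : W.dualAnnihilator) : W.comap N.subtype ≤ LinearMap.ker (g.1 ∘ₗ N.subtype) :=
    fun x hx => (Submodule.mem_dualAnnihilator _).1 g.2 _ hx
  refine ⟨{ toFun := fun g => (W.comap N.subtype).liftQ (g.1 ∘ₗ N.subtype) (hle g)
            map_add' := fun g g' => by ext; rfl
            map_smul' := fun t g => by ext; rfl }, fun φ => ?_, fun g => ?_⟩
  · obtain ⟨g, hg⟩ := LinearMap.exists_extend (φ ∘ₗ (W.comap N.subtype).mkQ)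
    have hgN (x : N) : g x = φ ((W.comap N.subtype).mkQ x) := DFunLike.congr_fun hg x
    refine ⟨⟨g, (Submodule.mem_dualAnnihilator _).2 fun w hw => ?_⟩, ?_⟩
    · have h : (W.comap N.subtype).mkQ ⟨w, hWN hw⟩ = 0 :=
        (Submodule.Quotient.mk_eq_zero _).2 hw
      rw [hgN ⟨w, hWN hw⟩, h, map_zero]
    · ext x
      exact hgN x
  · constructor
    · intro h x hx
      exact DFunLike.congr_fun h (Submodule.Quotient.mk ⟨x, hx⟩)
    · intro h
      ext x
      exact h x x.2

namespace scalarTwoCocycle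

set_option maxSynthPendingDepth 3

/-- The dimension of the second cohomology of a Lie algebra with trivial scalar coefficients. -/
noncomputable def cohomologyDim (k L : Type*) [Field k] [LieRing L] [LieAlgebra k L] : ℕ :=
  finrank k (scalarTwoCocycle k L ⧸ LinearMap.range (coboundary k L))

/-- Hopf's formula in dual form: the Schur multiplier computed from a free presentation of `L`
has the dimension of the second scalar cohomology of `L`. -/
theorem finrank_multiplier_eq {X k L : Type*} [Field k] [LieRing L] [LieAlgebra k L]
    (π : FreeLieAlgebra k X →ₗ⁅k⁆ L) (hπ : Function.Surjective π) :
    finrank k (↥(π.ker.toSubmodule ⊓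
      (⁅(⊤ : LieIdeal k (FreeLieAlgebra k X)), (⊤ : LieIdeal k (FreeLieAlgebra k X))⁆).toSubmodule) ⧸
        (⁅(⊤ : LieIdeal k (FreeLieAlgebra k X)), π.ker⁆).toSubmodule.comap
          (π.ker.toSubmodule ⊓ (⁅(⊤ : LieIdeal k (FreeLieAlgebra k X)),
            (⊤ : LieIdeal k (FreeLieAlgebra k X))⁆).toSubmodule).subtype) =
      cohomologyDim k L := by
  let F := FreeLieAlgebra k X
  let D : LieIdeal k F := ⁅(⊤ : LieIdeal k F), (⊤ : LieIdeal k F)⁆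
  let W : LieIdeal k F := ⁅(⊤ : LieIdeal k F), π.ker⁆
  have hWN : W.toSubmodule ≤ π.ker.toSubmodule ⊓ D.toSubmodule :=
    le_inf (LieSubmodule.lie_le_right (π.ker : LieIdeal k F) ⊤)
      (LieSubmodule.mono_lie_right ⊤ le_top)
  have hD : D.toSubmodule = Submodule.span k {z | ∃ x y : F, ⁅x, y⁆ = z} := by
    rw [LieSubmodule.lieIdeal_oper_eq_linear_span']
    simp
  obtain ⟨Ψ, hΨ, hΨ0⟩ := Submodule.exists_dualAnnihilator_to_dual_quotient hWN
  obtain ⟨Φ, hΦ⟩ := exists_descent π hπ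
  have hΦsurj : Function.Surjective Φ := by
    intro ω
    obtain ⟨g, hg⟩ := exists_primitive_of_free π ω
    have hgW : g ∈ W.toSubmodule.dualAnnihilator := by
      rw [Submodule.mem_dualAnnihilator]
      intro w hw
      rw [LieSubmodule.lieIdeal_oper_eq_linear_span'] at hw
      induction hw using Submodule.span_induction with
      | mem w hw =>
        obtain ⟨x, -, r, hr, rfl⟩ := hw
        rw [hg, LieHom.mem_ker.1 hr, map_zero]
      | zero => exact map_zero g
      | add _ _ _ _ h h' => rw [map_add, h, h', add_zero]
      | smul t _ _ h => rw [map_smul, h, smul_zero]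
    refine ⟨⟨g, hgW⟩, Subtype.ext (LinearMap.ext fun a => LinearMap.ext fun b => ?_)⟩
    obtain ⟨x, rfl⟩ := hπ a
    obtain ⟨y, rfl⟩ := hπ b
    rw [hΦ, hg]
  change finrank k (↥(π.ker.toSubmodule ⊓ D.toSubmodule) ⧸ W.toSubmodule.comap
    (π.ker.toSubmodule ⊓ D.toSubmodule).subtype) = _
  rw [← Subspace.dual_finrank_eq, cohomologyDim]
  refine LinearMap.finrank_eq_of_surjective_of_ker_eq hΨ
    (g := (LinearMap.range (coboundary k L)).mkQ ∘ₗ Φ)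
    ((Submodule.mkQ_surjective _).comp hΦsurj) fun g => ?_
  rw [hΨ0, LinearMap.comp_apply, Submodule.mkQ_apply, Submodule.Quotient.mk_eq_zero]
  constructor
  · intro h
    let p : D.toSubmodule →ₗ[k] L := (π : F →ₗ[k] L) ∘ₗ D.toSubmodule.subtype
    have hmem : g.1 ∘ₗ D.toSubmodule.subtype ∈ LinearMap.range p.dualMap := by
      rw [LinearMap.range_dualMap_eq_dualAnnihilator_ker, Submodule.mem_dualAnnihilator]
      exact fun x hx => h x ⟨LieHom.mem_ker.2 hx, x.2⟩
    obtain ⟨f, hf⟩ := hmem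
    refine ⟨f, Subtype.ext (LinearMap.ext fun a => LinearMap.ext fun b => ?_)⟩
    obtain ⟨x, rfl⟩ := hπ a
    obtain ⟨y, rfl⟩ := hπ b
    rw [hΦ, coboundary_apply, ← LieHom.map_lie]
    exact DFunLike.congr_fun hf ⟨⁅x, y⁆, LieSubmodule.lie_mem_lie (LieSubmodule.mem_top x)
      (LieSubmodule.mem_top y)⟩
  · rintro ⟨f, hf⟩ x ⟨hxR, hxD⟩
    have hfg : D.toSubmodule ≤ LinearMap.eqLocus (f ∘ₗ (π : F →ₗ[k] L)) g.1 := by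
      rw [hD, Submodule.span_le]
      rintro _ ⟨x, y, rfl⟩
      change f (π ⁅x, y⁆) = g.1 ⁅x, y⁆
      rw [← hΦ, ← hf, coboundary_apply, LieHom.map_lie]
    have hx : f (π x) = g.1 x := hfg hxD
    rw [← hx, LieHom.mem_ker.1 hxR, map_zero]

section Prod

theorem prod_lie {H K : Type} [LieRing H] [LieRing K] (p q : H × K) : ⁅p, q⁆ = (⁅p.1, q.1⁆, ⁅p.2, q.2⁆) := rfl

variable {k H K : Type} [Field k] [LieRing H] [LieAlgebra k H] [LieRing K] [LieAlgebra k K]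

/-- The abelianization of a Lie algebra, as a vector space. -/
abbrev Abelianization (k L : Type) [Field k] [LieRing L] [LieAlgebra k L] : Type :=
  L ⧸ (⁅(⊤ : LieIdeal k L), (⊤ : LieIdeal k L)⁆).toSubmodule

theorem mkQ_lie {L : Type} [LieRing L] [LieAlgebra k L] (x y : L) :
    (⁅(⊤ : LieIdeal k L), (⊤ : LieIdeal k L)⁆).toSubmodule.mkQ ⁅x, y⁆ = 0 :=
  (Submodule.Quotient.mk_eq_zero _).2
    (LieSubmodule.lie_mem_lie (LieSubmodule.mem_top x) (LieSubmodule.mem_top y))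

/-- A linear map killing all brackets factors through the abelianization. -/
theorem exists_abelianization_lift {L V : Type} [LieRing L] [LieAlgebra k L]
    [AddCommGroup V] [Module k V] (f : L →ₗ[k] V) (hf : ∀ x y : L, f ⁅x, y⁆ = 0) :
    ∃ g : Abelianization k L →ₗ[k] V, ∀ x, g (Submodule.mkQ _ x) = f x := by
  refine ⟨Submodule.liftQ _ f ?_, fun _ => rfl⟩
  rw [LieSubmodule.lieIdeal_oper_eq_linear_span', Submodule.span_le]
  rintro _ ⟨x, -, y, -, rfl⟩
  exact hf x y

variable (k H K) in
/-- The 2-cocycle on `H × K` assembled from 2-cocycles on the factors and a pairing of the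
abelianizations. -/
def ofProd : scalarTwoCocycle k H × scalarTwoCocycle k K ×
    (Abelianization k H →ₗ[k] Abelianization k K →ₗ[k] k) →ₗ[k] scalarTwoCocycle k (H × K) where
  toFun a := ⟨LinearMap.mk₂ k (fun p q => a.1.1 p.1 q.1 + a.2.1.1 p.2 q.2 +
      (a.2.2 (Submodule.mkQ _ p.1) (Submodule.mkQ _ q.2) -
        a.2.2 (Submodule.mkQ _ q.1) (Submodule.mkQ _ p.2)))
      (fun p p' q => by
        simp only [Prod.fst_add, Prod.snd_add, map_add, LinearMap.add_apply]; ring)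
      (fun t p q => by
        simp only [Prod.smul_fst, Prod.smul_snd, map_smul, LinearMap.smul_apply, smul_eq_mul]
        ring)
      (fun p q q' => by
        simp only [Prod.fst_add, Prod.snd_add, map_add, LinearMap.add_apply]; ring)
      (fun t p q => by
        simp only [Prod.smul_fst, Prod.smul_snd, map_smul, LinearMap.smul_apply, smul_eq_mul]
        ring), by
    refine ⟨fun p => ?_, fun p q r => ?_⟩
    · simp only [LinearMap.mk₂_apply, a.1.2.1, a.2.1.2.1]
      ring
    · simp only [LinearMap.mk₂_apply, prod_lie, mkQ_lie, map_zero, LinearMap.zero_apply]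
      linear_combination a.1.2.2 p.1 q.1 r.1 + a.2.1.2.2 p.2 q.2 r.2⟩
  map_add' a b := by
    refine Subtype.ext (LinearMap.ext fun p => LinearMap.ext fun q => ?_)
    simp only [LinearMap.mk₂_apply, Prod.fst_add, Prod.snd_add, Submodule.coe_add,
      LinearMap.add_apply]
    ring
  map_smul' t a := by
    refine Subtype.ext (LinearMap.ext fun p => LinearMap.ext fun q => ?_)
    simp only [LinearMap.mk₂_apply, Prod.smul_fst, Prod.smul_snd, Submodule.coe_smul,
      LinearMap.smul_apply, smul_eq_mul, RingHom.id_apply]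
    ring

theorem ofProd_apply (α : scalarTwoCocycle k H) (β : scalarTwoCocycle k K)
    (b : Abelianization k H →ₗ[k] Abelianization k K →ₗ[k] k) (p q : H × K) :
    (ofProd k H K (α, β, b)).1 p q = α.1 p.1 q.1 + β.1 p.2 q.2 +
      (b (Submodule.mkQ _ p.1) (Submodule.mkQ _ q.2) -
        b (Submodule.mkQ _ q.1) (Submodule.mkQ _ p.2)) := rfl

theorem ofProd_surjective : Function.Surjective (ofProd k H K) := by
  intro ω
  let i : H →ₗ[k] H × K := LinearMap.inl k H K
  let j : K →ₗ[k] H × K := LinearMap.inr k H K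
  have hi (x y : H) : i ⁅x, y⁆ = ⁅i x, i y⁆ := by simp [i]
  have hj (x y : K) : j ⁅x, y⁆ = ⁅j x, j y⁆ := by simp [j]
  have hij (x : H) (y : K) : ⁅i x, j y⁆ = 0 := by simp [i, j]
  have hji (x : H) (y : K) : ⁅j y, i x⁆ = 0 := by simp [i, j]
  have hα : ω.1.compl₁₂ i i ∈ scalarTwoCocycle k H :=
    ⟨fun x => ω.2.1 (i x), fun x y z => by simpa [hi] using ω.2.2 (i x) (i y) (i z)⟩
  have hβ : ω.1.compl₁₂ j j ∈ scalarTwoCocycle k K :=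
    ⟨fun x => ω.2.1 (j x), fun x y z => by simpa [hj] using ω.2.2 (j x) (j y) (j z)⟩
  have hb₁ (x y : H) (z : K) : ω.1 (i ⁅x, y⁆) (j z) = 0 := by
    simpa [hi, hij, hji] using ω.2.2 (i x) (i y) (j z)
  have hb₂ (x y : K) (z : H) : ω.1 (i z) (j ⁅x, y⁆) = 0 := by
    rw [skew, neg_eq_zero]
    simpa [hj, hij, hji] using ω.2.2 (j x) (j y) (i z)
  obtain ⟨b, hb⟩ := exists_abelianization_lift (ω.1.compl₁₂ i j)
    fun x y => LinearMap.ext fun z => hb₁ x y z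
  obtain ⟨c, hc⟩ := exists_abelianization_lift b.flip fun x y => by
    refine LinearMap.ext fun a => ?_
    obtain ⟨z, rfl⟩ := Submodule.mkQ_surjective _ a
    rw [LinearMap.flip_apply, hb]
    exact hb₂ x y z
  have hcb (x : H) (y : K) :
      c.flip (Submodule.mkQ _ x) (Submodule.mkQ _ y) = ω.1 (i x) (j y) := by
    rw [LinearMap.flip_apply, hc, LinearMap.flip_apply, hb]
    rfl
  refine ⟨(⟨_, hα⟩, ⟨_, hβ⟩, c.flip),
    Subtype.ext (LinearMap.ext fun p => LinearMap.ext fun q => ?_)⟩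
  have split (p : H × K) : p = i p.1 + j p.2 := by simp [i, j]
  rw [ofProd_apply, hcb, hcb]
  conv_rhs => rw [split p, split q]
  simp only [map_add, LinearMap.add_apply, LinearMap.compl₁₂_apply]
  rw [skew ω (j p.2) (i q.1)]
  ring

theorem ofProd_mem_range_coboundary_iff (α : scalarTwoCocycle k H) (β : scalarTwoCocycle k K)
    (b : Abelianization k H →ₗ[k] Abelianization k K →ₗ[k] k) :
    ofProd k H K (α, β, b) ∈ LinearMap.range (coboundary k (H × K)) ↔
      α ∈ LinearMap.range (coboundary k H) ∧ β ∈ LinearMap.range (coboundary k K) ∧ b = 0 := by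
  constructor
  · rintro ⟨f, hf⟩
    have key (p q : H × K) : f ⁅p, q⁆ = α.1 p.1 q.1 + β.1 p.2 q.2 +
        (b (Submodule.mkQ _ p.1) (Submodule.mkQ _ q.2) -
          b (Submodule.mkQ _ q.1) (Submodule.mkQ _ p.2)) := by
      rw [← coboundary_apply, hf, ofProd_apply]
    refine ⟨⟨f ∘ₗ LinearMap.inl k H K,
      Subtype.ext (LinearMap.ext fun x => LinearMap.ext fun y => ?_)⟩, ⟨f ∘ₗ LinearMap.inr k H K,
      Subtype.ext (LinearMap.ext fun x => LinearMap.ext fun y => ?_)⟩,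
      LinearMap.ext fun x => LinearMap.ext fun y => ?_⟩
    · simpa [prod_lie] using key (x, 0) (y, 0)
    · simpa [prod_lie] using key (0, x) (0, y)
    · obtain ⟨x, rfl⟩ := Submodule.mkQ_surjective _ x
      obtain ⟨y, rfl⟩ := Submodule.mkQ_surjective _ y
      have h : f ((0, 0) : H × K) = 0 := map_zero f
      simpa [prod_lie, h] using (key (x, 0) (0, y)).symm
  · rintro ⟨⟨f, rfl⟩, ⟨g, rfl⟩, rfl⟩
    refine ⟨f.coprod g, Subtype.ext (LinearMap.ext fun p => LinearMap.ext fun q => ?_)⟩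
    rw [ofProd_apply]
    simp

/-- The Künneth formula for the second scalar cohomology of a product of Lie algebras. -/
theorem cohomologyDim_prod [Module.Finite k H] [Module.Finite k K] :
    cohomologyDim k (H × K) = cohomologyDim k H + cohomologyDim k K +
      finrank k (Abelianization k H) * finrank k (Abelianization k K) := by
  rw [cohomologyDim, LinearMap.finrank_eq_of_surjective_of_ker_eq
    (f := (LinearMap.range (coboundary k (H × K))).mkQ ∘ₗ ofProd k H K)
    (g := (LinearMap.range (coboundary k H)).mkQ.prodMap
      ((LinearMap.range (coboundary k K)).mkQ.prodMap LinearMap.id))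
    ((Submodule.mkQ_surjective _).comp ofProd_surjective)
    ((Submodule.mkQ_surjective _).prodMap
      ((Submodule.mkQ_surjective _).prodMap Function.surjective_id))]
  · rw [cohomologyDim, cohomologyDim, finrank_prod, finrank_prod, finrank_linearMap,
      finrank_linearMap, finrank_self, mul_one, add_assoc]
  · rintro ⟨α, β, b⟩
    rw [LinearMap.comp_apply, Submodule.mkQ_apply, Submodule.Quotient.mk_eq_zero,
      ofProd_mem_range_coboundary_iff]
    simp [Prod.ext_iff, -LinearMap.mem_range]

end Prod

end scalarTwoCocycle

/-- The Schur multiplier computed from any free presentation of `L` has the dimension of the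
second cohomology of `L` with trivial scalar coefficients. -/
theorem schurMultiplierDim_eq_cohomologyDim {X L : Type} [LieRing L] [LieAlgebra ℂ L]
    (π : FreeLieAlgebra ℂ X →ₗ⁅ℂ⁆ L) (hπ : Function.Surjective π) :
    schurMultiplierDim π = scalarTwoCocycle.cohomologyDim ℂ L :=
  scalarTwoCocycle.finrank_multiplier_eq π hπ

/-- For finite-dimensional complex Lie algebras `H` and `K`,
`dim M(H ⊕ K) = dim M(H) + dim M(K) + dim (H/[H,H]) · dim (K/[K,K])`, where the Schur
multipliers are computed from any free presentations of `H ⊕ K`, `H` and `K`. -/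
theorem schurMultiplierDim_prod (H K : Type) [LieRing H] [LieAlgebra ℂ H]
    [LieRing K] [LieAlgebra ℂ K] [Module.Finite ℂ H] [Module.Finite ℂ K]
    (X Y Z : Type)
    (πHK : FreeLieAlgebra ℂ X →ₗ⁅ℂ⁆ H × K) (hπHK : Function.Surjective πHK)
    (πH : FreeLieAlgebra ℂ Y →ₗ⁅ℂ⁆ H) (hπH : Function.Surjective πH)
    (πK : FreeLieAlgebra ℂ Z →ₗ⁅ℂ⁆ K) (hπK : Function.Surjective πK) :
    schurMultiplierDim πHK =
      schurMultiplierDim πH + schurMultiplierDim πK +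
        Module.finrank ℂ (H ⧸ ⁅(⊤ : LieIdeal ℂ H), (⊤ : LieIdeal ℂ H)⁆) *
          Module.finrank ℂ (K ⧸ ⁅(⊤ : LieIdeal ℂ K), (⊤ : LieIdeal ℂ K)⁆) := by
  rw [schurMultiplierDim_eq_cohomologyDim πHK hπHK, schurMultiplierDim_eq_cohomologyDim πH hπH,
    schurMultiplierDim_eq_cohomologyDim πK hπK]
  exact scalarTwoCocycle.cohomologyDim_prod
end
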